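/- Let v₀, v₁, v₂, v₃ ∈ EuclideanSpace ℝ (Fin 3) be affinely independent, let τ = convexHull ℝ {v₀, v₁, v₂, v₃} be the corresponding simplex, and let φ : EuclideanSpace ℝ (Fin 3) → ℝ be an affine map. Then τ ∩ {x : φ(x) ≥ 0} equals the convex hull of the set P ∪ Z, where P = {v_i : φ(v_i) ≥ 0} is the set of vertices at which φ is nonnegative, and Z is the set of points z lying on a segment [v_i, v_j] with φ(v_i) > 0 > φ(v_j) and φ(z) = 0 (the edge zero-crossings). -/

import Mathlib

open scoped Pointwise in
/-- A nonnegative combination of points of a convex set `C`, homogenised by recording its total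
weight, stays in the family of dilates of `C`. -/
def Convex.homogenization {E : Type*} [AddCommGroup E] [Module ℝ E] {C : Set E}
    (hC : Convex ℝ C) (hne : C.Nonempty) : PointedCone ℝ (E × ℝ) where
  carrier := {p | 0 ≤ p.2 ∧ ∃ y ∈ C, p.1 = p.2 • y}
  zero_mem' := ⟨le_rfl, hne.some, hne.some_mem, by simp⟩
  add_mem' := by
    rintro ⟨p, a⟩ ⟨q, b⟩ ⟨ha, y, hy, hp : p = a • y⟩ ⟨hb, z, hz, hq : q = b • z⟩
    subst hp hq
    refine ⟨add_nonneg ha hb, ?_⟩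
    have h : a • y + b • z ∈ (a + b) • C := by
      rw [hC.add_smul ha hb]
      exact Set.add_mem_add (Set.smul_mem_smul_set hy) (Set.smul_mem_smul_set hz)
    obtain ⟨u, hu, h⟩ := h
    exact ⟨u, hu, h.symm⟩
  smul_mem' := by
    rintro ⟨c, hc⟩ ⟨p, a⟩ ⟨ha, y, hy, hp : p = a • y⟩
    subst hp
    exact ⟨mul_nonneg hc ha, y, hy, smul_smul c a y⟩

/-- The part of a polytope in an affine half-space lies in the convex hull of the retained
vertices and the zero-crossings on edges. -/
theorem convexHull_range_inter_halfSpace_subset {E ι : Type*} [AddCommGroup E] [Module ℝ E]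
    [Fintype ι] (v : ι → E) (φ : E →ᵃ[ℝ] ℝ) :
    convexHull ℝ (Set.range v) ∩ {x | 0 ≤ φ x} ⊆
      convexHull ℝ
        ({p | ∃ i, p = v i ∧ 0 ≤ φ (v i)} ∪
          {z | ∃ i j, 0 < φ (v i) ∧ φ (v j) < 0 ∧
            z ∈ segment ℝ (v i) (v j) ∧ φ z = 0}) := by
  classical
  rintro x ⟨hx, hφx⟩
  rw [convexHull_range_eq_exists_affineCombination] at hx
  obtain ⟨s, w, hw, hsum, rfl⟩ := hx
  rw [Set.mem_ofPred_eq, Finset.map_affineCombination _ _ _ hsum,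
    Finset.affineCombination_eq_linear_combination _ _ _ hsum] at hφx
  rw [Finset.affineCombination_eq_linear_combination _ _ _ hsum]
  simp only [Function.comp_apply, smul_eq_mul] at hφx
  set K := {p | ∃ i, p = v i ∧ 0 ≤ φ (v i)} ∪
    {z | ∃ i j, 0 < φ (v i) ∧ φ (v j) < 0 ∧ z ∈ segment ℝ (v i) (v j) ∧ φ z = 0}
  have hne : (convexHull ℝ K).Nonempty := by
    obtain ⟨i, hi⟩ : ∃ i, 0 ≤ φ (v i) := by
      by_contra! hneg
      have h0 := (Finset.sum_eq_zero_iff_of_nonpos fun i hi ↦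
        mul_nonpos_of_nonneg_of_nonpos (hw i hi) (hneg i).le).1
        (le_antisymm (Finset.sum_nonpos fun i hi ↦
          mul_nonpos_of_nonneg_of_nonpos (hw i hi) (hneg i).le) hφx)
      have : ∑ i ∈ s, w i = 0 := Finset.sum_eq_zero fun i hi ↦
        (mul_eq_zero.1 (h0 i hi)).resolve_right (hneg i).ne
      linarith
    exact ⟨v i, subset_convexHull ℝ K (Or.inl ⟨i, rfl, hi⟩)⟩
  set D := (convex_convexHull ℝ K).homogenization hne
  have vertex_mem {i : ι} (hi : 0 ≤ φ (v i)) : (v i, (1 : ℝ)) ∈ D :=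
    ⟨zero_le_one, v i, subset_convexHull ℝ K (Or.inl ⟨i, rfl, hi⟩), (one_smul ℝ _).symm⟩
  have crossing_mem {i j : ι} (hi : 0 < φ (v i)) (hj : φ (v j) < 0) :
      (-φ (v j)) • (v i, (1 : ℝ)) + φ (v i) • (v j, (1 : ℝ)) ∈ D := by
    have hd : 0 < φ (v i) - φ (v j) := by linarith
    have hd' := hd.ne'
    set t := φ (v i) / (φ (v i) - φ (v j)) with ht
    refine ⟨by simp; linarith, AffineMap.lineMap (v i) (v j) t,
      subset_convexHull ℝ K (Or.inr ⟨i, j, hi, hj, ?_, ?_⟩), ?_⟩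
    · rw [segment_eq_image_lineMap]
      exact ⟨t, ⟨by positivity, (div_le_one hd).2 (by linarith)⟩, rfl⟩
    · rw [AffineMap.apply_lineMap, AffineMap.lineMap_apply_module, smul_eq_mul, smul_eq_mul, ht]
      field_simp
      ring
    · simp only [Prod.fst_add, Prod.snd_add, Prod.smul_fst, Prod.smul_snd, smul_eq_mul, mul_one,
        AffineMap.lineMap_apply_module, smul_add, smul_smul, ht]
      congr 2 <;> field_simp <;> ring
  -- split the combination according to the sign of `φ` at the vertices
  let p (i : ι) : ℝ := max (φ (v i)) 0
  let n (i : ι) : ℝ := max (-φ (v i)) 0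
  let eP (i : ι) : E × ℝ := if 0 ≤ φ (v i) then (v i, 1) else 0
  let eN (i : ι) : E × ℝ := if 0 ≤ φ (v i) then 0 else (v i, 1)
  have pair_mem (i j : ι) : n j • eP i + p i • eN j ∈ D := by
    by_cases hj : 0 ≤ φ (v j)
    · simp [n, eN, hj]
    · by_cases hi : 0 ≤ φ (v i)
      · rcases hi.eq_or_lt with h | h
        · simpa [p, eP, ← h] using D.smul_mem (le_max_right _ _) (vertex_mem hi)
        · simpa [p, n, eP, eN, hi, hj, max_eq_left (neg_nonneg.2 (not_le.1 hj).le)] using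
            crossing_mem h (not_le.1 hj)
      · simp [p, eP, hi, max_eq_right (not_le.1 hi).le]
  have eP_mem (i : ι) : eP i ∈ D := by
    by_cases hi : 0 ≤ φ (v i)
    · simpa [eP, hi] using vertex_mem hi
    · simp [eP, hi]
  set A := ∑ i ∈ s, w i • eP i
  set B := ∑ i ∈ s, w i • eN i
  set P := ∑ i ∈ s, w i * p i with hP
  set N := ∑ i ∈ s, w i * n i with hN
  have hA : A ∈ D := sum_mem fun i hi ↦ D.smul_mem (hw i hi) (eP_mem i)
  have hAB : A + B = (∑ i ∈ s, w i • v i, 1) := by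
    have (i : ι) : w i • eP i + w i • eN i = (w i • v i, w i) := by
      by_cases hi : 0 ≤ φ (v i) <;> simp [eP, eN, hi]
    rw [← Finset.sum_add_distrib, Finset.sum_congr rfl fun i _ ↦ this i, ← hsum]
    exact Prod.ext Prod.fst_sum Prod.snd_sum
  have hNP : N ≤ P := by
    have : P - N = ∑ i ∈ s, w i * φ (v i) := by
      rw [hP, hN, ← Finset.sum_sub_distrib]
      refine Finset.sum_congr rfl fun i _ ↦ ?_
      rcases le_total 0 (φ (v i)) with h | h <;> simp [p, n, h]
    linarith
  have hN0 : 0 ≤ N := Finset.sum_nonneg fun i hi ↦ mul_nonneg (hw i hi) (le_max_right _ _)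
  have hD : A + B ∈ D := by
    rcases hN0.eq_or_lt with h | h
    · have hB0 : B = 0 := Finset.sum_eq_zero fun i hi ↦ by
        have h0 := (Finset.sum_eq_zero_iff_of_nonneg fun i hi ↦
          mul_nonneg (hw i hi) (le_max_right _ _)).1 h.symm i hi
        by_cases hφ : 0 ≤ φ (v i)
        · simp [eN, hφ]
        · have : 0 < n i := lt_max_of_lt_left (neg_pos.2 (not_le.1 hφ))
          rw [(mul_eq_zero.1 h0).resolve_right this.ne', zero_smul]
      simpa [hB0] using hA
    · have hpos : 0 < P := h.trans_le hNP
      have hpair : N • A + P • B ∈ D := by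
        have : N • A + P • B =
            ∑ i ∈ s, ∑ j ∈ s, (w i * w j) • (n j • eP i + p i • eN j) := by
          simp only [smul_add, Finset.sum_add_distrib]
          congr 1
          · rw [Finset.sum_comm, hN, Finset.sum_smul_sum]
            refine Finset.sum_congr rfl fun i _ ↦ Finset.sum_congr rfl fun j _ ↦ ?_
            simp only [smul_smul]
            ring_nf
          · rw [hP, Finset.sum_smul_sum]
            refine Finset.sum_congr rfl fun i _ ↦ Finset.sum_congr rfl fun j _ ↦ ?_
            simp only [smul_smul]
            ring_nf
        rw [this]
        exact sum_mem fun i hi ↦ sum_mem fun j hj ↦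
          D.smul_mem (mul_nonneg (hw i hi) (hw j hj)) (pair_mem i j)
      have key := D.smul_mem (inv_nonneg.2 hpos.le)
        (D.add_mem (D.smul_mem (sub_nonneg.2 hNP) hA) hpair)
      rwa [← add_assoc, ← add_smul, sub_add_cancel, ← smul_add, inv_smul_smul₀ hpos.ne'] at key
  rw [hAB] at hD
  obtain ⟨-, y, hy, h⟩ := hD
  rw [one_smul] at h
  exact Set.mem_of_eq_of_mem h hy

/-- Marching tetrahedra correctness: let `v 0, v 1, v 2, v 3` be affinely independent
points of `ℝ³`, `τ` the simplex `convexHull ℝ {v 0, v 1, v 2, v 3}` and `φ` an affine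
map `ℝ³ → ℝ`. Then `τ ∩ {x : φ x ≥ 0}` is the convex hull of `P ∪ Z`, where
`P = {v i : φ (v i) ≥ 0}` is the set of simplex vertices at which `φ` is nonnegative
and `Z` is the set of zero-crossings of `φ` on edges `[v i, v j]` with
`φ (v i) > 0 > φ (v j)`. -/
theorem stmt_10 (v : Fin 4 → EuclideanSpace ℝ (Fin 3))
    (hv : AffineIndependent ℝ v)
    (φ : EuclideanSpace ℝ (Fin 3) →ᵃ[ℝ] ℝ) :
    convexHull ℝ (Set.range v) ∩ {x | 0 ≤ φ x} =
      convexHull ℝ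
        ({p | ∃ i, p = v i ∧ 0 ≤ φ (v i)} ∪
          {z | ∃ i j, 0 < φ (v i) ∧ φ (v j) < 0 ∧
            z ∈ segment ℝ (v i) (v j) ∧ φ z = 0}) := by
  refine (convexHull_range_inter_halfSpace_subset v φ).antisymm
    (convexHull_min ?_ ((convex_convexHull ℝ _).inter ((convex_Ici (0 : ℝ)).affine_preimage φ)))
  rintro _ (⟨i, rfl, hi⟩ | ⟨i, j, -, -, hz, h0⟩)
  · exact ⟨subset_convexHull ℝ _ (Set.mem_range_self i), hi⟩
  · exact ⟨(convex_convexHull ℝ _).segment_subset (subset_convexHull ℝ _ (Set.mem_range_self i))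
      (subset_convexHull ℝ _ (Set.mem_range_self j)) hz, h0.ge⟩
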